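/- Let A and B be unital Pro-C*-algebras, V ⊆ A a local operator subspace, and φ : V → B a local completely contractive linear map. Define the local operator system S_V^l = { [[λ·1, v],[w*, μ·1]] : λ, μ ∈ ℂ, v, w ∈ V } ⊆ M_2(A) and Φ : S_V^l → M_2(B) by Φ([[λ1, v],[w*, μ1]]) = [[λ1, φ(v)],[φ(w)*, μ1]]. Then Φ is local completely positive. -/

import Mathlib

open scoped ComplexOrder

noncomputable section

variable {V : Type} [AddCommGroup V] [Module ℂ V]

/-- Conjugation `Xᴴ A X` of a `V`-valued matrix by a scalar matrix `X`. -/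
def sconj {n m : ℕ} (X : Matrix (Fin n) (Fin m) ℂ)
    (A : Matrix (Fin n) (Fin n) V) : Matrix (Fin m) (Fin m) V :=
  Matrix.of fun i j => ∑ p, ∑ q, ((starRingEnd ℂ) (X p i) * X q j) • A p q

/-- A (not necessarily proper) cone in a complex vector space. -/
def IsVCone {M : Type} [AddCommGroup M] [Module ℂ M] (C : Set M) : Prop :=
  (0 : M) ∈ C ∧ (∀ x ∈ C, ∀ y ∈ C, x + y ∈ C) ∧
    ∀ r : ℝ, 0 ≤ r → ∀ x ∈ C, (r : ℂ) • x ∈ C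

/-- A 2×2 block matrix of `n × n` blocks, reindexed to `Fin (n+n)`. -/
def blk {n : ℕ} (A B C D : Matrix (Fin n) (Fin n) V) :
    Matrix (Fin (n + n)) (Fin (n + n)) V :=
  Matrix.reindex finSumFinEquiv finSumFinEquiv (Matrix.fromBlocks A B C D)

/-- The diagonal matrix `diag (e, …, e)`. -/
def diagE (e : V) (n : ℕ) : Matrix (Fin n) (Fin n) V :=
  Matrix.diagonal fun _ => e

variable [StarAddMonoid V] [StarModule ℂ V]

/-- The seminorm at level `(α, n)` induced by the matrix cones `C` and the unit `e`:
`‖X‖_α^n = inf { r ≥ 0 : [[r eₙ, X],[X*, r eₙ]] ∈ C_α^{2n} }`. -/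
def nrm {Γ : Type} (C : Γ → (k : ℕ) → Set (Matrix (Fin k) (Fin k) V)) (e : V)
    (α : Γ) (n : ℕ) (X : Matrix (Fin n) (Fin n) V) : ℝ :=
  sInf {r : ℝ | 0 ≤ r ∧
    blk ((r : ℂ) • diagE e n) X (star X) ((r : ℂ) • diagE e n) ∈ C α (n + n)}

/-- A local matrix *-ordering on `V`: a downward filtered family of compatible matrix
cones of hermitian matrices whose total intersection with their negatives is trivial. -/
structure LMOrder (Γ : Type) (V : Type) [AddCommGroup V] [Module ℂ V]
    [StarAddMonoid V] [StarModule ℂ V] where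
  C : Γ → (n : ℕ) → Set (Matrix (Fin n) (Fin n) V)
  cone : ∀ α n, IsVCone (C α n)
  herm : ∀ α n, ∀ A ∈ C α n, star A = A
  filtered : ∀ α β : Γ, ∃ γ, ∀ n, C γ n ⊆ C α n ∩ C β n
  proper : ∀ n (A : Matrix (Fin n) (Fin n) V), (∀ α, A ∈ C α n ∧ -A ∈ C α n) → A = 0
  compat : ∀ (α : Γ) (n m : ℕ) (X : Matrix (Fin n) (Fin m) ℂ),
    ∀ A ∈ C α n, sconj X A ∈ C α m

/-- An abstract local operator system: a local matrix *-ordering together with an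
Archimedean matrix order unit. -/
structure LocalOpSys (Γ : Type) (V : Type) [AddCommGroup V] [Module ℂ V]
    [StarAddMonoid V] [StarModule ℂ V] extends LMOrder Γ V where
  e : V
  eherm : star e = e
  unit : ∀ (α : Γ) (n : ℕ) (A : Matrix (Fin n) (Fin n) V), star A = A →
    ∃ r : ℝ, 0 < r ∧ (r : ℂ) • diagE e n - A ∈ C α n
  arch : ∀ (α : Γ) (n : ℕ) (A : Matrix (Fin n) (Fin n) V),
    (∀ r : ℝ, 0 < r → (r : ℂ) • diagE e n + A ∈ C α n) → A ∈ C α n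

/-- An Archimedean local order unit space (`A.L.O.U.` space): ground-level cones only. -/
structure ALOU (Γ : Type) (V : Type) [AddCommGroup V] [Module ℂ V]
    [StarAddMonoid V] [StarModule ℂ V] where
  pos : Γ → Set V
  cone : ∀ α, IsVCone (pos α)
  herm : ∀ α, ∀ v ∈ pos α, star v = v
  filtered : ∀ α β : Γ, ∃ γ, pos γ ⊆ pos α ∩ pos β
  proper : ∀ v : V, (∀ α, v ∈ pos α ∧ -v ∈ pos α) → v = 0
  e : V
  eherm : star e = e
  unit : ∀ (α : Γ) (v : V), star v = v → ∃ r : ℝ, 0 < r ∧ (r : ℂ) • e - v ∈ pos α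
  arch : ∀ (α : Γ) (v : V), (∀ r : ℝ, 0 < r → (r : ℂ) • e + v ∈ pos α) → v ∈ pos α

/-- The minimal matrix cones over a family of ground-level cones. -/
def Cmin {Γ : Type} (pos : Γ → Set V) (α : Γ) (n : ℕ) :
    Set (Matrix (Fin n) (Fin n) V) :=
  {A | ∀ L : Fin n → ℂ, (∑ i, ∑ j, ((starRingEnd ℂ) (L i) * L j) • A i j) ∈ pos α}

/-- The maximal matrix cones over a family of ground-level cones:
sums `Σ aᵢ ⊗ vᵢ` with `aᵢ` positive semidefinite scalar matrices and `vᵢ` positive. -/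
def Dmax {Γ : Type} (pos : Γ → Set V) (α : Γ) (n : ℕ) :
    Set (Matrix (Fin n) (Fin n) V) :=
  {A | ∃ (k : ℕ) (a : Fin k → Matrix (Fin n) (Fin n) ℂ) (v : Fin k → V),
    (∀ i, (a i).PosSemidef) ∧ (∀ i, v i ∈ pos α) ∧
    A = Matrix.of fun p q => ∑ i, (a i p q) • v i}

/-- The amplification `φ⁽ᵏ⁾` of a matrix-valued linear map, realized on the index
type `Fin k × ι`. -/
def ampP {S : Type} [AddCommGroup S] [Module ℂ S] {k : ℕ} {ι : Type} [Fintype ι]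
    (φ : S →ₗ[ℂ] Matrix ι ι ℂ) (M : Matrix (Fin k) (Fin k) S) :
    Matrix (Fin k × ι) (Fin k × ι) ℂ :=
  Matrix.of fun ip jq => φ (M ip.1 jq.1) ip.2 jq.2

end

/-- Flatten `M_k(M_2(X))` into `M_{2k}(X)`. -/
def flat2 {X : Type} {k : ℕ} (M : Matrix (Fin k) (Fin k) (Matrix (Fin 2) (Fin 2) X)) :
    Matrix (Fin (k * 2)) (Fin (k * 2)) X :=
  Matrix.reindex finProdFinEquiv finProdFinEquiv
    (Matrix.of fun (p q : Fin k × Fin 2) => M p.1 q.1 p.2 q.2)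

section MatrixCalculus

variable {A : Type} [Ring A] [Algebra ℂ A]

/-- A scalar matrix regarded as a matrix over a unital complex algebra. -/
def scalarMat (A : Type) [Ring A] [Algebra ℂ A] {m n : Type} (X : Matrix m n ℂ) :
    Matrix m n A :=
  X.map (algebraMap ℂ A)

theorem scalarMat_mul {l m n : Type} [Fintype m] (X : Matrix l m ℂ) (Y : Matrix m n ℂ) :
    scalarMat A (X * Y) = scalarMat A X * scalarMat A Y :=
  Matrix.map_mul

theorem scalarMat_one {m : Type} [DecidableEq m] : scalarMat A (1 : Matrix m m ℂ) = 1 := by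
  simp [scalarMat]

theorem scalarMat_add_smul_one {m : Type} [DecidableEq m] (X : Matrix m m ℂ) (z : ℂ) :
    scalarMat A (z • 1 + X) = z • 1 + scalarMat A X := by
  ext i j
  by_cases h : i = j <;> simp [scalarMat, h, Algebra.algebraMap_eq_smul_one, add_smul]

theorem scalarMat_smul_one {m : Type} [DecidableEq m] (z : ℂ) :
    scalarMat A (z • (1 : Matrix m m ℂ)) = z • 1 := by
  simpa [scalarMat] using scalarMat_add_smul_one (A := A) (0 : Matrix m m ℂ) z

theorem fromBlocks_conj [StarRing A] {m : Type} [Fintype m] (X Y : Matrix m m ℂ)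
    (a b c d : Matrix m m A) :
    (scalarMat A (Matrix.fromBlocks X 0 0 Y)).conjTranspose * Matrix.fromBlocks a b c d *
        scalarMat A (Matrix.fromBlocks X 0 0 Y) =
      Matrix.fromBlocks ((scalarMat A X).conjTranspose * a * scalarMat A X)
        ((scalarMat A X).conjTranspose * b * scalarMat A Y)
        ((scalarMat A Y).conjTranspose * c * scalarMat A X)
        ((scalarMat A Y).conjTranspose * d * scalarMat A Y) := by
  simp [scalarMat, Matrix.fromBlocks_map, Matrix.fromBlocks_conjTranspose,
    Matrix.fromBlocks_multiply]

variable [StarRing A] [StarModule ℂ A]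

theorem scalarMat_conjTranspose {m n : Type} (X : Matrix m n ℂ) :
    scalarMat A X.conjTranspose = (scalarMat A X).conjTranspose :=
  Matrix.conjTranspose_map _ fun z => algebraMap_star_comm z

/-- `Xᴴ M Y` for a matrix `M` with entries in a complex vector space. -/
def biconj {W : Type} [AddCommGroup W] [Module ℂ W] {l m n : Type} [Fintype m]
    (X : Matrix m l ℂ) (M : Matrix m m W) (Y : Matrix m n ℂ) : Matrix l n W :=
  Matrix.of fun i j => ∑ p, ∑ q, ((starRingEnd ℂ) (X p i) * Y q j) • M p q

theorem biconj_map {W : Type} [AddCommGroup W] [Module ℂ W] {l m n : Type} [Fintype m]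
    (f : W →ₗ[ℂ] A) (X : Matrix m l ℂ) (M : Matrix m m W) (Y : Matrix m n ℂ) :
    (biconj X M Y).map f = (scalarMat A X).conjTranspose * M.map f * scalarMat A Y := by
  ext i j
  simp only [biconj, scalarMat, Matrix.map_apply, Matrix.of_apply, map_sum, map_smul,
    Matrix.mul_apply, Matrix.conjTranspose_apply, Finset.sum_mul]
  rw [Finset.sum_comm]
  refine Finset.sum_congr rfl fun q _ => Finset.sum_congr rfl fun p _ => ?_
  rw [← algebraMap_star_comm, ← Algebra.commutes (Y q j), ← mul_assoc, ← map_mul,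
    mul_comm (Y q j), ← Algebra.smul_def]
  rfl

theorem sconj_eq {n m : ℕ} (X : Matrix (Fin n) (Fin m) ℂ) (P : Matrix (Fin n) (Fin n) A) :
    sconj X P = (scalarMat A X).conjTranspose * P * scalarMat A X :=
  biconj_map (LinearMap.id : A →ₗ[ℂ] A) X P X

end MatrixCalculus

theorem fromBlocks_add_smul_one {A m : Type} [Ring A] [Algebra ℂ A] [DecidableEq m]
    (z : ℂ) (a b c d : Matrix m m A) :
    z • (1 : Matrix (m ⊕ m) (m ⊕ m) A) + Matrix.fromBlocks a b c d =
      Matrix.fromBlocks (z • 1 + a) b c (z • 1 + d) := by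
  rw [← Matrix.fromBlocks_one, Matrix.fromBlocks_smul, Matrix.fromBlocks_add]
  simp

open scoped MatrixOrder Matrix.Norms.L2Operator in
theorem Matrix.PosDef.exists_isUnit_conjTranspose_mul_self {m : Type} [Fintype m]
    [DecidableEq m] {Q : Matrix m m ℂ} (hQ : Q.PosDef) :
    ∃ X : Matrix m m ℂ, IsUnit X ∧ Q = X.conjTranspose * X :=
  CStarAlgebra.isStrictlyPositive_iff_eq_star_mul_self.mp
    (Matrix.isStrictlyPositive_iff_posDef.mpr hQ)

theorem Matrix.PosSemidef.smul_one_add_posDef {m : Type} [Fintype m] [DecidableEq m]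
    {Q : Matrix m m ℂ} (hQ : Q.PosSemidef) {r : ℝ} (hr : 0 < r) :
    ((r : ℂ) • (1 : Matrix m m ℂ) + Q).PosDef :=
  (Matrix.PosDef.one.smul (by exact_mod_cast hr)).add_posSemidef hQ

namespace LocalOpSys

variable {Γ A : Type} [Ring A] [Algebra ℂ A] [StarRing A] [StarModule ℂ A]
  (T : LocalOpSys Γ A)

theorem reindex_conj_mem {α : Γ} {l m : Type} [Fintype l] [Fintype m]
    {n k : ℕ} (e : m ≃ Fin n) (f : l ≃ Fin k) (X : Matrix m l ℂ) {P : Matrix m m A}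
    (hP : Matrix.reindex e e P ∈ T.C α n) :
    Matrix.reindex f f ((scalarMat A X).conjTranspose * P * scalarMat A X) ∈ T.C α k := by
  have h := T.compat α n k (Matrix.reindex e f X) _ hP
  rw [sconj_eq] at h
  convert h using 1
  simp only [Matrix.reindex_apply]
  rw [← Matrix.submatrix_mul_equiv _ _ _ e.symm, ← Matrix.submatrix_mul_equiv _ _ _ e.symm]
  rfl

variable {T}

theorem diagE_eq_one (hT : T.e = 1) (n : ℕ) : diagE T.e n = 1 := by
  rw [hT]
  exact Matrix.diagonal_one

theorem smul_one_mem (hT : T.e = 1) (α : Γ) (n : ℕ) {r : ℝ} (hr : 0 ≤ r) :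
    (r : ℂ) • (1 : Matrix (Fin n) (Fin n) A) ∈ T.C α n := by
  obtain ⟨s, hs, h⟩ := T.unit α n 0 (star_zero _)
  rw [diagE_eq_one hT, sub_zero] at h
  have := (T.cone α n).2.2 (r / s) (by positivity) _ h
  rwa [smul_smul, ← Complex.ofReal_mul, div_mul_cancel₀ _ hs.ne'] at this

theorem reindex_mem_of_forall_pos (hT : T.e = 1) {α : Γ} {m : Type} [DecidableEq m]
    {n : ℕ} (e : m ≃ Fin n) {P : Matrix m m A}
    (hP : ∀ r : ℝ, 0 < r → Matrix.reindex e e ((r : ℂ) • 1 + P) ∈ T.C α n) :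
    Matrix.reindex e e P ∈ T.C α n := by
  refine T.arch α n _ fun r hr => ?_
  convert hP r hr using 1
  rw [diagE_eq_one hT]
  simp only [Matrix.reindex_apply, Matrix.submatrix_add, Matrix.submatrix_smul, Pi.add_apply,
    Pi.smul_apply, Matrix.submatrix_one_equiv]

theorem blk_smul_one {A : Type} [Ring A] [Algebra ℂ A] [StarRing A] (r : ℂ)
    {n : ℕ} (X : Matrix (Fin n) (Fin n) A) :
    blk (r • 1) X (star X) (r • 1) = r • 1 + blk 0 X (star X) 0 := by
  rw [← Matrix.submatrix_one_equiv (finSumFinEquiv (m := n) (n := n)).symm]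
  simp only [blk, Matrix.reindex_apply]
  rw [← add_zero (r • (1 : Matrix (Fin n) (Fin n) A)), ← fromBlocks_add_smul_one]
  rfl

theorem star_blk {A : Type} [Ring A] [StarRing A] {n : ℕ} (X : Matrix (Fin n) (Fin n) A) :
    star (blk 0 X (star X) 0) = blk 0 X (star X) 0 := by
  simp [blk, Matrix.star_eq_conjTranspose, Matrix.fromBlocks_conjTranspose]

theorem blk_one_mem_iff (hT : T.e = 1) {α : Γ} {n : ℕ} {X : Matrix (Fin n) (Fin n) A} :
    blk 1 X (star X) 1 ∈ T.C α (n + n) ↔ nrm T.C T.e α n X ≤ 1 := by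
  simp only [nrm, diagE_eq_one hT]
  constructor
  · intro h
    exact csInf_le ⟨0, fun r hr => hr.1⟩ ⟨zero_le_one, by simpa using h⟩
  · intro h
    have hne : {r : ℝ | 0 ≤ r ∧ blk ((r : ℂ) • 1) X (star X) ((r : ℂ) • 1) ∈
        T.C α (n + n)}.Nonempty := by
      obtain ⟨r, hr, hm⟩ := T.unit α (n + n) (-blk 0 X (star X) 0)
        (by rw [star_neg, star_blk])
      refine ⟨r, hr.le, ?_⟩
      rwa [diagE_eq_one hT, sub_neg_eq_add, ← blk_smul_one] at hm
    refine T.arch α _ _ fun r hr => ?_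
    obtain ⟨s, ⟨-, hs⟩, hlt⟩ := exists_lt_of_csInf_lt hne (h.trans_lt (lt_add_of_pos_left 1 hr))
    have hadd := (T.cone α _).2.1 _ (smul_one_mem hT α (n + n) (sub_nonneg.mpr hlt.le)) _ hs
    rw [diagE_eq_one hT]
    convert hadd using 1
    have h1 := blk_smul_one 1 X
    rw [one_smul] at h1
    rw [blk_smul_one, h1, ← add_assoc, ← add_assoc, ← add_smul, ← add_smul]
    push_cast
    congr 2
    ring

theorem posSemidef_of_mem {α : Γ} (hα : (-1 : Matrix (Fin 1) (Fin 1) A) ∉ T.C α 1)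
    {m : Type} [Fintype m] {n : ℕ} (e : m ≃ Fin n)
    {Q : Matrix m m ℂ} (hQ : Q.IsHermitian)
    (h : Matrix.reindex e e (scalarMat A Q) ∈ T.C α n) : Q.PosSemidef := by
  refine .of_dotProduct_mulVec_nonneg hQ fun x => ?_
  by_contra hneg
  have him : (star x ⬝ᵥ Q.mulVec x).im = 0 := hQ.im_star_dotProduct_mulVec_self x
  set c := star x ⬝ᵥ Q.mulVec x with hc
  have hre : c.re < 0 := by
    by_contra hre
    exact hneg (Complex.nonneg_iff.mpr ⟨not_lt.mp hre, him.symm⟩)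
  have hmem := T.reindex_conj_mem e (Equiv.refl (Fin 1)) (Matrix.replicateCol (Fin 1) x) h
  rw [← scalarMat_conjTranspose, ← scalarMat_mul, ← scalarMat_mul] at hmem
  have hone : (Matrix.replicateCol (Fin 1) x).conjTranspose * Q * Matrix.replicateCol (Fin 1) x =
      (c.re : ℂ) • 1 := by
    have hcc : (c.re : ℂ) = c := Complex.ext rfl (by simp [him])
    rw [hcc, hc, Matrix.mul_assoc]
    ext i j
    fin_cases i
    fin_cases j
    simp [Matrix.mul_apply, dotProduct, Matrix.mulVec]
  rw [hone] at hmem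
  have hscale := (T.cone α 1).2.2 (-c.re)⁻¹ (by rw [inv_nonneg]; linarith) _ hmem
  apply hα
  convert hscale using 1
  have hz : ((-c.re)⁻¹ : ℝ) * (c.re : ℂ) = -1 := by
    have : (c.re : ℂ) ≠ 0 := by exact_mod_cast hre.ne
    push_cast
    field_simp
  rw [scalarMat_smul_one, Matrix.reindex_refl_refl, smul_smul, hz, neg_one_smul]

theorem exists_neg_one_notMem [Nontrivial A] (hT : T.e = 1) :
    ∃ α, (-1 : Matrix (Fin 1) (Fin 1) A) ∉ T.C α 1 := by
  by_contra! h
  exact one_ne_zero (T.proper 1 1 fun α =>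
    ⟨by simpa using smul_one_mem hT α 1 zero_le_one, h α⟩)

/-- Rescaling by the invertible square roots of the (perturbed) diagonal blocks reduces
positivity on the Paulsen system to blocks with unit diagonal. -/
theorem fromBlocks_mem_of_blk_one_mem {ΓB B : Type} [Ring B] [Algebra ℂ B] [StarRing B]
    [StarModule ℂ B] {TB : LocalOpSys ΓB B} (hT : T.e = 1) (hTB : TB.e = 1)
    {Vs : Submodule ℂ A} {φ : Vs →ₗ[ℂ] B} {α : Γ} {β : ΓB}
    (hα : (-1 : Matrix (Fin 1) (Fin 1) A) ∉ T.C α 1)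
    {k : ℕ}
    (hφ : ∀ V : Matrix (Fin k) (Fin k) Vs,
      blk 1 (V.map Vs.subtype) (star (V.map Vs.subtype)) 1 ∈ T.C α (k + k) →
        blk 1 (V.map φ) (star (V.map φ)) 1 ∈ TB.C β (k + k))
    {n : ℕ} (e : Fin k ⊕ Fin k ≃ Fin n) {L U : Matrix (Fin k) (Fin k) ℂ}
    (hL : L.IsHermitian) (hU : U.IsHermitian) (V : Matrix (Fin k) (Fin k) Vs)
    (h : Matrix.reindex e e (Matrix.fromBlocks (scalarMat A L) (V.map Vs.subtype)
      (V.map Vs.subtype).conjTranspose (scalarMat A U)) ∈ T.C α n) :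
    Matrix.reindex e e (Matrix.fromBlocks (scalarMat B L) (V.map φ)
      (V.map φ).conjTranspose (scalarMat B U)) ∈ TB.C β n := by
  have hLp : L.PosSemidef := by
    refine posSemidef_of_mem hα (Equiv.refl _) hL ?_
    have := T.reindex_conj_mem e (Equiv.refl (Fin k)) (Matrix.fromRows 1 0) h
    simpa [scalarMat, Matrix.fromRows_map, Matrix.conjTranspose_fromRows_eq_fromCols_conjTranspose,
      Matrix.fromCols_mul_fromBlocks, Matrix.fromCols_mul_fromRows] using this
  have hUp : U.PosSemidef := by
    refine posSemidef_of_mem hα (Equiv.refl _) hU ?_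
    have := T.reindex_conj_mem e (Equiv.refl (Fin k)) (Matrix.fromRows 0 1) h
    simpa [scalarMat, Matrix.fromRows_map, Matrix.conjTranspose_fromRows_eq_fromCols_conjTranspose,
      Matrix.fromCols_mul_fromBlocks, Matrix.fromCols_mul_fromRows] using this
  refine reindex_mem_of_forall_pos hTB e fun r hr => ?_
  obtain ⟨X, hX, hLX⟩ := (hLp.smul_one_add_posDef hr).exists_isUnit_conjTranspose_mul_self
  obtain ⟨Y, hY, hUY⟩ := (hUp.smul_one_add_posDef hr).exists_isUnit_conjTranspose_mul_self
  obtain ⟨X', hXX', hX'X⟩ := isUnit_iff_exists.mp hX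
  obtain ⟨Y', hYY', hY'Y⟩ := isUnit_iff_exists.mp hY
  have hr' : Matrix.reindex e e ((r : ℂ) • 1 + Matrix.fromBlocks (scalarMat A L)
      (V.map Vs.subtype) (V.map Vs.subtype).conjTranspose (scalarMat A U)) ∈ T.C α n := by
    have := (T.cone α n).2.1 _ (smul_one_mem hT α n hr.le) _ h
    convert this using 1
    simp only [Matrix.reindex_apply, Matrix.submatrix_add, Matrix.submatrix_smul, Pi.add_apply,
      Pi.smul_apply, Matrix.submatrix_one_equiv]
  rw [fromBlocks_add_smul_one, ← scalarMat_add_smul_one, ← scalarMat_add_smul_one, hLX, hUY]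
    at hr' ⊢
  have cancel : ∀ {D : Type} [Ring D] [Algebra ℂ D] [StarRing D] [StarModule ℂ D]
      {Z Z' : Matrix (Fin k) (Fin k) ℂ}, Z * Z' = 1 →
      (scalarMat D Z').conjTranspose * scalarMat D (Z.conjTranspose * Z) * scalarMat D Z' = 1 := by
    intro D _ _ _ _ Z Z' hZ
    rw [← scalarMat_conjTranspose, ← scalarMat_mul, ← scalarMat_mul, ← Matrix.mul_assoc,
      ← Matrix.conjTranspose_mul, hZ, Matrix.mul_assoc, hZ]
    simp [scalarMat_one]
  have key := T.reindex_conj_mem e finSumFinEquiv (Matrix.fromBlocks X' 0 0 Y') hr'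
  rw [fromBlocks_conj, cancel hXX', cancel hYY', ← biconj_map] at key
  have hstar : (scalarMat A Y').conjTranspose * (V.map Vs.subtype).conjTranspose *
      scalarMat A X' = star ((biconj X' V Y').map Vs.subtype) := by
    rw [biconj_map]
    simp [Matrix.star_eq_conjTranspose, Matrix.conjTranspose_mul, Matrix.mul_assoc]
  rw [hstar] at key
  have hB := TB.reindex_conj_mem finSumFinEquiv e (Matrix.fromBlocks X 0 0 Y)
    (hφ (biconj X' V Y') key)
  have hcan : ∀ {Z Z' : Matrix (Fin k) (Fin k) ℂ}, Z' * Z = 1 →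
      scalarMat B Z' * scalarMat B Z = 1 := by
    intro Z Z' hZ
    rw [← scalarMat_mul, hZ, scalarMat_one]
  have hoff : (scalarMat B X).conjTranspose * (biconj X' V Y').map φ * scalarMat B Y =
      V.map φ := by
    rw [biconj_map, Matrix.mul_assoc, Matrix.mul_assoc, Matrix.mul_assoc, hcan hY'Y,
      ← Matrix.mul_assoc, ← Matrix.conjTranspose_mul, hcan hX'X]
    simp
  have hoff' : (scalarMat B Y).conjTranspose * star ((biconj X' V Y').map φ) * scalarMat B X =
      (V.map φ).conjTranspose := by
    rw [← hoff]
    simp [Matrix.star_eq_conjTranspose, Matrix.conjTranspose_mul, Matrix.mul_assoc]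
  rw [fromBlocks_conj, hoff, hoff', Matrix.mul_one, Matrix.mul_one, ← scalarMat_conjTranspose,
    ← scalarMat_conjTranspose, ← scalarMat_mul, ← scalarMat_mul] at hB
  exact hB

end LocalOpSys

/-- The shuffle `k + k ≃ k * 2` sending the two summands to the two residues mod `2`. -/
def shuffleEquiv (k : ℕ) : Fin k ⊕ Fin k ≃ Fin (k * 2) :=
  Equiv.trans (β := Fin k × Fin 2)
    { toFun := Sum.elim (fun i => (i, 0)) fun i => (i, 1)
      invFun := fun p => if p.2 = 0 then Sum.inl p.1 else Sum.inr p.1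
      left_inv := by rintro (i | i) <;> simp
      right_inv := by rintro ⟨i, j⟩; fin_cases j <;> simp } finProdFinEquiv

theorem flat2_eq_reindex {X : Type} {k : ℕ}
    (M : Matrix (Fin k) (Fin k) (Matrix (Fin 2) (Fin 2) X)) :
    flat2 M = Matrix.reindex (shuffleEquiv k) (shuffleEquiv k)
      (Matrix.fromBlocks (Matrix.of fun i j => M i j 0 0) (Matrix.of fun i j => M i j 0 1)
        (Matrix.of fun i j => M i j 1 0) (Matrix.of fun i j => M i j 1 1)) := by
  rw [← Equiv.symm_apply_eq]
  ext (i | i) (j | j) <;> simp [flat2, shuffleEquiv]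

/-- local Paulsen off-diagonal technique: if `φ : V → B` is local
completely contractive then the associated map `Φ` on the local Paulsen system
`S_V^l ⊆ M_2(A)` is local completely positive. -/
theorem statement16 {ΓA ΓB A B : Type}
    [Ring A] [Algebra ℂ A] [StarRing A] [StarModule ℂ A]
    [Ring B] [Algebra ℂ B] [StarRing B] [StarModule ℂ B]
    (TA : LocalOpSys ΓA A) (hTAe : TA.e = 1)
    (TB : LocalOpSys ΓB B) (hTBe : TB.e = 1)
    (Vs : Submodule ℂ A) (φ : Vs →ₗ[ℂ] B)
    (hφ : ∀ β : ΓB, ∃ α : ΓA, ∀ (k : ℕ) (M : Matrix (Fin k) (Fin k) Vs),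
      nrm TB.C TB.e β k (M.map fun s => φ s) ≤
        nrm TA.C TA.e α k (M.map fun s => (s : A)))
    (Φ : Matrix (Fin 2) (Fin 2) A →ₗ[ℂ] Matrix (Fin 2) (Fin 2) B)
    (hΦ : ∀ (lam mu : ℂ) (v w : Vs),
      Φ (Matrix.of ![![lam • (1 : A), (v : A)], ![star (w : A), mu • (1 : A)]]) =
        Matrix.of ![![lam • (1 : B), φ v], ![star (φ w), mu • (1 : B)]]) :
    ∀ β : ΓB, ∃ α : ΓA, ∀ (k : ℕ)
      (M : Matrix (Fin k) (Fin k) (Matrix (Fin 2) (Fin 2) A)),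
      (∀ i j, ∃ (lam mu : ℂ) (v w : Vs),
        M i j = Matrix.of ![![lam • (1 : A), (v : A)], ![star (w : A), mu • (1 : A)]]) →
      flat2 M ∈ TA.C α (k * 2) → flat2 (M.map ⇑Φ) ∈ TB.C β (k * 2) := by
  intro β
  obtain ⟨α₁, hα₁⟩ := hφ β
  rcases subsingleton_or_nontrivial A with hA | hA
  · have h10 : (1 : B) = 0 := by
      have h := (hΦ 1 1 0 0).symm.trans ((congrArg Φ (Subsingleton.elim _ _)).trans (hΦ 0 0 0 0))
      simpa using congrFun (congrFun h 0) 0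
    have : Subsingleton B := subsingleton_of_zero_eq_one h10.symm
    exact ⟨α₁, fun k M _ _ => by
      rw [Subsingleton.elim (flat2 (M.map ⇑Φ)) 0]
      exact (TB.cone β _).1⟩
  obtain ⟨α₂, hα₂⟩ := TA.exists_neg_one_notMem hTAe
  obtain ⟨α, hα⟩ := TA.filtered α₁ α₂
  refine ⟨α, fun k M hM hpos => ?_⟩
  choose L U V W hM using hM
  have hΦM : ∀ i j, (M.map ⇑Φ) i j =
      Matrix.of ![![L i j • (1 : B), φ (V i j)], ![star (φ (W i j)), U i j • (1 : B)]] :=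
    fun i j => by rw [Matrix.map_apply, hM, hΦ]
  rw [flat2_eq_reindex] at hpos
  have hherm := TA.herm α _ _ hpos
  rw [Matrix.star_eq_conjTranspose, Matrix.conjTranspose_reindex, EmbeddingLike.apply_eq_iff_eq,
    Matrix.fromBlocks_conjTranspose, Matrix.fromBlocks_inj] at hherm
  obtain ⟨h₁, h₂, -, h₄⟩ := hherm
  have hW : ∀ i j, W i j = V j i := fun i j => by
    have := congrFun (congrFun h₂ j) i
    simp only [hM, Matrix.conjTranspose_apply, Matrix.of_apply, Matrix.cons_val_zero,
      Matrix.cons_val_one, star_star] at this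
    exact Subtype.ext this
  have hinj : ∀ a b : ℂ, star (a • (1 : A)) = b • 1 → star a = b := fun a b h => by
    rw [star_smul, star_one] at h
    exact smul_left_injective ℂ one_ne_zero h
  have hL : (Matrix.of L).IsHermitian := by
    ext i j
    have := congrFun (congrFun h₁ i) j
    simp only [hM, Matrix.conjTranspose_apply, Matrix.of_apply, Matrix.cons_val_zero] at this
    exact hinj _ _ this
  have hU : (Matrix.of U).IsHermitian := by
    ext i j
    have := congrFun (congrFun h₄ i) j
    simp only [hM, Matrix.conjTranspose_apply, Matrix.of_apply, Matrix.cons_val_one] at this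
    exact hinj _ _ this
  have hmem := LocalOpSys.fromBlocks_mem_of_blk_one_mem (β := β) (φ := φ) hTAe hTBe
    (fun h => hα₂ (hα 1 h).2) (fun N hN => (LocalOpSys.blk_one_mem_iff hTBe).mpr
      ((hα₁ k N).trans ((LocalOpSys.blk_one_mem_iff hTAe).mp (hα _ hN).1)))
    (shuffleEquiv k) hL hU (Matrix.of V) (by
      convert hpos using 3 <;> ext i j <;>
        simp [hM, hW, scalarMat, Algebra.algebraMap_eq_smul_one])
  rw [flat2_eq_reindex]
  convert hmem using 3 <;> ext i j <;>
    simp only [hΦM, hW] <;> simp [scalarMat, Algebra.algebraMap_eq_smul_one]
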